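/- Let q be a prime power, F a finite field with q elements, n ≥ 4, and let 𝓛 be a Cameron–Liebler line class (Cameron–Liebler 1-set) of AG(n,q) with |𝓛| = 2·[n 1]_q (parameter 2). Let p₁ and p₂ be distinct projective points with p₁ ≤ H∞ and p₂ ≤ H∞. Then there are exactly two lines of 𝓛 through p₁ and exactly two through p₂, and for any ℓ₁, ℓ₂ ∈ 𝓛 with ℓ₁ ≠ ℓ₂, p₁ ≤ ℓ₁, p₁ ≤ ℓ₂ and any r₁, r₂ ∈ 𝓛 with r₁ ≠ r₂, p₂ ≤ r₁, p₂ ≤ r₂, the submodule ℓ₁ ⊔ ℓ₂ ⊔ r₁ ⊔ r₂ has finrank at most 4 (the four lines generate at most a projective 3-space). -/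

import Mathlib

open Module

/-- The Gaussian binomial coefficient `[a b]_q`. -/
noncomputable def gaussBinom (q a b : ℕ) : ℚ :=
  ∏ i ∈ Finset.range b, ((q : ℚ) ^ (a - i) - 1) / ((q : ℚ) ^ (i + 1) - 1)

variable {F : Type} [Field F] [Fintype F] {n : ℕ}

/-- `K` is a projective `j`-space of `PG(n,q)`: a submodule of rank `j+1`. -/
def IsProjSub (j : ℕ) (K : Submodule F (Fin (n + 1) → F)) : Prop :=
  Module.finrank F K = j + 1

/-- `P` is a projective point: a submodule of rank `1`. -/
def IsProjPoint (P : Submodule F (Fin (n + 1) → F)) : Prop :=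
  Module.finrank F P = 1

/-- `P` is an affine point w.r.t. the hyperplane at infinity `Hinf`. -/
def IsAffPoint (Hinf P : Submodule F (Fin (n + 1) → F)) : Prop :=
  Module.finrank F P = 1 ∧ ¬ P ≤ Hinf

/-- `K` is an affine `j`-space (a `j`-space of `AG(n,q)`). -/
def IsAffSub (j : ℕ) (Hinf K : Submodule F (Fin (n + 1) → F)) : Prop :=
  Module.finrank F K = j + 1 ∧ ¬ K ≤ Hinf

/-- `M` is a Cameron–Liebler `k`-set of `PG(n,q)`. -/
def IsCLProj (k : ℕ) (M : Set (Submodule F (Fin (n + 1) → F))) : Prop :=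
  (∀ K ∈ M, IsProjSub k K) ∧
  ∃ w : Submodule F (Fin (n + 1) → F) → ℝ,
    ∀ K, IsProjSub k K →
      Set.indicator M (fun _ => (1 : ℝ)) K =
        ∑ᶠ P ∈ {P | IsProjPoint P ∧ P ≤ K}, w P

/-- `L` is a Cameron–Liebler `k`-set of `AG(n,q)`. -/
def IsCLAff (k : ℕ) (Hinf : Submodule F (Fin (n + 1) → F))
    (L : Set (Submodule F (Fin (n + 1) → F))) : Prop :=
  (∀ K ∈ L, IsAffSub k Hinf K) ∧
  ∃ w : Submodule F (Fin (n + 1) → F) → ℝ,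
    ∀ K, IsAffSub k Hinf K →
      Set.indicator L (fun _ => (1 : ℝ)) K =
        ∑ᶠ P ∈ {P | IsAffPoint Hinf P ∧ P ≤ K}, w P

/-- `S` is a `k`-spread of `AG(n,q)`: every affine point is on exactly one member. -/
def IsSpread (k : ℕ) (Hinf : Submodule F (Fin (n + 1) → F))
    (S : Set (Submodule F (Fin (n + 1) → F))) : Prop :=
  (∀ K ∈ S, IsAffSub k Hinf K) ∧
  ∀ P, IsAffPoint Hinf P → ∃! K, K ∈ S ∧ P ≤ K


omit [Fintype F] in
/-- If an affine point `P` and a point `p` at infinity lie on a line `K`, they span it. -/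
lemma sup_eq_line {Hinf P p K : Submodule F (Fin (n + 1) → F)} (hP : IsAffPoint Hinf P)
    (hp : IsProjPoint p) (hpH : p ≤ Hinf) (hK : finrank F K = 2) (hPK : P ≤ K) (hpK : p ≤ K) :
    P ⊔ p = K := by
  refine Submodule.eq_of_le_of_finrank_le (sup_le hPK hpK) ?_
  have hlt : p < P ⊔ p := lt_of_le_of_ne le_sup_right
    fun h => hP.2 ((le_sup_left.trans h.symm.le).trans hpH)
  have := Submodule.finrank_lt_finrank_of_lt hlt
  unfold IsProjPoint at hp
  omega

omit [Fintype F] in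
/-- An affine point and a point at infinity span an affine line. -/
lemma isAffSub_sup {Hinf P p : Submodule F (Fin (n + 1) → F)} (hP : IsAffPoint Hinf P)
    (hp : IsProjPoint p) (hpH : p ≤ Hinf) : IsAffSub 1 Hinf (P ⊔ p) := by
  refine ⟨?_, fun h => hP.2 (le_sup_left.trans h)⟩
  have hlt : p < P ⊔ p := lt_of_le_of_ne le_sup_right
    fun h => hP.2 ((le_sup_left.trans h.symm.le).trans hpH)
  have := Submodule.finrank_lt_finrank_of_lt hlt
  have := Submodule.finrank_add_le_finrank_add_finrank P p
  have := hP.1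
  unfold IsProjPoint at hp
  omega

/-- The affine lines in `S` through a point at infinity of `S` partition the affine points of `S`,
so the number of them in a Cameron–Liebler class is the weight of `S`. -/
lemma ncard_lines_through_eq_weight {Hinf p S : Submodule F (Fin (n + 1) → F)}
    {L : Set (Submodule F (Fin (n + 1) → F))} {w : Submodule F (Fin (n + 1) → F) → ℝ}
    (hL : ∀ K ∈ L, IsAffSub 1 Hinf K)
    (hw : ∀ K, IsAffSub 1 Hinf K → Set.indicator L (fun _ => (1 : ℝ)) K =
      ∑ᶠ P ∈ {P | IsAffPoint Hinf P ∧ P ≤ K}, w P)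
    (hp : IsProjPoint p) (hpH : p ≤ Hinf) (hpS : p ≤ S) :
    (Set.ncard {ℓ ∈ L | p ≤ ℓ ∧ ℓ ≤ S} : ℝ) =
      ∑ᶠ P ∈ {P | IsAffPoint Hinf P ∧ P ≤ S}, w P := by
  classical
  have := Fintype.ofFinite (Submodule F (Fin (n + 1) → F))
  rw [finsum_mem_eq_toFinset_sum]
  rw [← Finset.sum_fiberwise_of_maps_to (g := fun P => P ⊔ p)
    (t := {K | IsAffSub 1 Hinf K ∧ p ≤ K ∧ K ≤ S})]
  · have hfib : ∀ K ∈ ({K | IsAffSub 1 Hinf K ∧ p ≤ K ∧ K ≤ S} : Finset _),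
        ∑ P ∈ {P | IsAffPoint Hinf P ∧ P ≤ S}.toFinset with P ⊔ p = K, w P =
          if K ∈ L then 1 else 0 := by
      intro K hK
      obtain ⟨hK, hpK, hKS⟩ := (Finset.mem_filter.1 hK).2
      have h := hw K hK
      rw [finsum_mem_eq_toFinset_sum, Set.indicator_apply] at h
      rw [h]
      refine Finset.sum_congr ?_ fun _ _ => rfl
      ext P
      simp only [Set.toFinset_ofPred, Finset.mem_filter, Finset.mem_univ, true_and]
      exact ⟨fun ⟨⟨hP, _⟩, h⟩ => ⟨hP, le_sup_left.trans h.le⟩,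
        fun ⟨hP, hPK⟩ => ⟨⟨hP, hPK.trans hKS⟩, sup_eq_line hP hp hpH hK.1 hPK hpK⟩⟩
    rw [Finset.sum_congr rfl hfib, Finset.sum_boole, Set.ncard_eq_toFinset_card']
    congr 2
    ext K
    simp only [Set.mem_toFinset, Set.mem_ofPred_eq, Finset.mem_filter, Finset.mem_univ, true_and]
    exact ⟨fun ⟨h, h'⟩ => ⟨⟨hL K h, h'⟩, h⟩, fun ⟨⟨_, h'⟩, h⟩ => ⟨h, h'⟩⟩
  · intro P hP
    obtain ⟨hP, hPS⟩ := Set.mem_toFinset.1 hP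
    simp only [Finset.mem_filter, Finset.mem_univ, true_and]
    exact ⟨isAffSub_sup hP hp hpH, le_sup_right, sup_le hPS hpS⟩

/-- The number of points of a projective subspace. -/
lemma ncard_points_le (S : Submodule F (Fin (n + 1) → F)) :
    Set.ncard {P : Submodule F (Fin (n + 1) → F) | IsProjPoint P ∧ P ≤ S} =
      ∑ i ∈ Finset.range (finrank F S), Fintype.card F ^ i := by
  rw [← Nat.card_eq_fintype_card, ← Projectivization.card_of_finrank F S rfl,
    Nat.card_congr (Projectivization.equivSubmodule F S), ← Nat.card_coe_set_eq]
  refine Nat.card_congr (Equiv.symm ?_)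
  exact
    { toFun := fun Q => ⟨Q.1.map S.subtype, by
        refine ⟨?_, Submodule.map_subtype_le S Q.1⟩
        unfold IsProjPoint
        rw [Submodule.finrank_map_subtype_eq, Q.2]⟩
      invFun := fun P => ⟨P.1.comap S.subtype, by
        rw [← Submodule.finrank_map_subtype_eq, Submodule.map_comap_subtype,
          inf_eq_right.2 P.2.2]
        exact P.2.1⟩
      left_inv := fun Q => Subtype.ext (Submodule.comap_map_eq_of_injective S.injective_subtype Q.1)
      right_inv := fun P => Subtype.ext (by
        simp only [Submodule.map_comap_subtype]
        exact inf_eq_right.2 P.2.2) }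

omit [Fintype F] in
/-- An affine line has exactly one point at infinity. -/
lemma finrank_inf_hyperplane {Hinf K : Submodule F (Fin (n + 1) → F)}
    (hH : finrank F Hinf = n) (hK : IsAffSub 1 Hinf K) : finrank F ↥(K ⊓ Hinf) = 1 := by
  have h := Submodule.finrank_sup_add_finrank_inf_eq K Hinf
  have hlt : Hinf < K ⊔ Hinf := lt_of_le_of_ne le_sup_right
    fun h => hK.2 (le_sup_left.trans h.symm.le)
  have h₁ := Submodule.finrank_lt_finrank_of_lt hlt
  have h₂ := Submodule.finrank_le (K ⊔ Hinf)
  have h₃ := hK.1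
  rw [finrank_fin_fun] at h₂
  omega

/-- Counting the lines of a class by their point at infinity. -/
lemma ncard_eq_mul_of_ncard_lines_through {Hinf : Submodule F (Fin (n + 1) → F)}
    {L : Set (Submodule F (Fin (n + 1) → F))} (hH : finrank F Hinf = n)
    (hL : ∀ K ∈ L, IsAffSub 1 Hinf K) {m : ℕ}
    (hm : ∀ p, IsProjPoint p → p ≤ Hinf → Set.ncard {ℓ ∈ L | p ≤ ℓ} = m) :
    L.ncard = (∑ i ∈ Finset.range n, Fintype.card F ^ i) * m := by
  classical
  have := Fintype.ofFinite (Submodule F (Fin (n + 1) → F))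
  have hc := ncard_points_le Hinf
  rw [hH, Set.ncard_eq_toFinset_card'] at hc
  rw [Set.ncard_eq_toFinset_card', ← hc, Finset.card_eq_sum_card_fiberwise
    (f := fun K => K ⊓ Hinf) (t := {P | IsProjPoint P ∧ P ≤ Hinf}.toFinset)]
  · rw [Finset.sum_const_nat]
    intro p hp
    obtain ⟨hp, hpH⟩ := Set.mem_toFinset.1 hp
    rw [← hm p hp hpH, Set.ncard_eq_toFinset_card']
    congr 1
    ext K
    simp only [Finset.mem_filter, Set.mem_toFinset, Set.mem_ofPred_eq]
    refine and_congr_right fun hK => ⟨fun h => h.symm.le.trans inf_le_left, fun h => ?_⟩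
    refine (Submodule.eq_of_le_of_finrank_eq (le_inf h hpH) ?_).symm
    rw [finrank_inf_hyperplane hH (hL K hK)]
    exact hp
  · intro K hK
    simp only [Set.coe_toFinset] at hK ⊢
    exact ⟨finrank_inf_hyperplane hH (hL K hK), inf_le_right⟩

theorem statement12 (q : ℕ) (hq : IsPrimePow q) (hF : Fintype.card F = q)
    (hn : 4 ≤ n)
    (Hinf : Submodule F (Fin (n + 1) → F)) (hH : Module.finrank F Hinf = n)
    (L : Set (Submodule F (Fin (n + 1) → F)))
    (hL : IsCLAff 1 Hinf L)
    (hcard : (L.ncard : ℚ) = 2 * gaussBinom q n 1)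
    (p₁ p₂ : Submodule F (Fin (n + 1) → F))
    (hp₁ : IsProjPoint p₁) (hp₂ : IsProjPoint p₂) (hne : p₁ ≠ p₂)
    (hp₁inf : p₁ ≤ Hinf) (hp₂inf : p₂ ≤ Hinf) :
    Set.ncard {ℓ ∈ L | p₁ ≤ ℓ} = 2 ∧ Set.ncard {ℓ ∈ L | p₂ ≤ ℓ} = 2 ∧
    ∀ ℓ₁ ℓ₂ r₁ r₂ : Submodule F (Fin (n + 1) → F),
      ℓ₁ ∈ L → ℓ₂ ∈ L → ℓ₁ ≠ ℓ₂ → p₁ ≤ ℓ₁ → p₁ ≤ ℓ₂ →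
      r₁ ∈ L → r₂ ∈ L → r₁ ≠ r₂ → p₂ ≤ r₁ → p₂ ≤ r₂ →
      Module.finrank F ↥(ℓ₁ ⊔ ℓ₂ ⊔ r₁ ⊔ r₂) ≤ 4 := by
  obtain ⟨hLine, w, hw⟩ := hL
  have hweight : ∀ p S : Submodule F (Fin (n + 1) → F), IsProjPoint p → p ≤ Hinf → p ≤ S →
      (Set.ncard {ℓ ∈ L | p ≤ ℓ ∧ ℓ ≤ S} : ℝ) =
        ∑ᶠ P ∈ {P | IsAffPoint Hinf P ∧ P ≤ S}, w P :=
    fun p S hp hpH hpS => ncard_lines_through_eq_weight hLine hw hp hpH hpS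
  have hconst : ∀ p p' S : Submodule F (Fin (n + 1) → F), IsProjPoint p → p ≤ Hinf → p ≤ S →
      IsProjPoint p' → p' ≤ Hinf → p' ≤ S →
      Set.ncard {ℓ ∈ L | p ≤ ℓ ∧ ℓ ≤ S} = Set.ncard {ℓ ∈ L | p' ≤ ℓ ∧ ℓ ≤ S} := by
    intro p p' S hp hpH hpS hp' hpH' hpS'
    exact_mod_cast (hweight p S hp hpH hpS).trans (hweight p' S hp' hpH' hpS').symm
  have htwo : Set.ncard {ℓ ∈ L | p₁ ≤ ℓ} = 2 := by
    have hmul := ncard_eq_mul_of_ncard_lines_through hH hLine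
      (m := Set.ncard {ℓ ∈ L | p₁ ≤ ℓ}) fun p hp hpH => by
        simpa using hconst p p₁ ⊤ hp hpH le_top hp₁ hp₁inf le_top
    have hq1 : (1 : ℚ) < q := by exact_mod_cast hq.one_lt
    have hgauss : gaussBinom q n 1 = ∑ i ∈ Finset.range n, (q : ℚ) ^ i := by
      rw [geom_sum_eq hq1.ne']
      simp [gaussBinom]
    have hpos : (0 : ℚ) < ∑ i ∈ Finset.range n, (q : ℚ) ^ i :=
      Finset.sum_pos (fun i _ => by positivity) ⟨0, Finset.mem_range.2 (by omega)⟩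
    rw [hmul, hF, hgauss, mul_comm (2 : ℚ)] at hcard
    push_cast at hcard
    exact_mod_cast mul_left_cancel₀ hpos.ne' hcard
  have htwo' : Set.ncard {ℓ ∈ L | p₂ ≤ ℓ} = 2 := by
    rw [← htwo]
    simpa using hconst p₂ p₁ ⊤ hp₂ hp₂inf le_top hp₁ hp₁inf le_top
  refine ⟨htwo, htwo', ?_⟩
  intro ℓ₁ ℓ₂ r₁ r₂ hℓ₁ hℓ₂ hℓ hpℓ₁ hpℓ₂ hr₁ hr₂ _ hpr₁ hpr₂
  set S := ℓ₁ ⊔ ℓ₂ ⊔ p₂ with hS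
  have hℓ₁S : ℓ₁ ≤ S := le_sup_left.trans le_sup_left
  have hℓ₂S : ℓ₂ ≤ S := le_sup_right.trans le_sup_left
  have hge : 2 ≤ Set.ncard {ℓ ∈ L | p₁ ≤ ℓ ∧ ℓ ≤ S} := by
    rw [← Set.ncard_pair hℓ]
    refine Set.ncard_le_ncard ?_ (Set.toFinite _)
    rintro K (rfl | rfl)
    exacts [⟨hℓ₁, hpℓ₁, hℓ₁S⟩, ⟨hℓ₂, hpℓ₂, hℓ₂S⟩]
  rw [hconst p₁ p₂ S hp₁ hp₁inf (hpℓ₁.trans hℓ₁S) hp₂ hp₂inf le_sup_right] at hge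
  have hall : {ℓ ∈ L | p₂ ≤ ℓ ∧ ℓ ≤ S} = {ℓ ∈ L | p₂ ≤ ℓ} :=
    Set.eq_of_subset_of_ncard_le (fun K hK => ⟨hK.1, hK.2.1⟩) (htwo'.le.trans hge)
      (Set.toFinite _)
  have hr₁S : r₁ ≤ S := (hall.symm.subset ⟨hr₁, hpr₁⟩ : _ ∈ {ℓ ∈ L | p₂ ≤ ℓ ∧ ℓ ≤ S}).2.2
  have hr₂S : r₂ ≤ S := (hall.symm.subset ⟨hr₂, hpr₂⟩ : _ ∈ {ℓ ∈ L | p₂ ≤ ℓ ∧ ℓ ≤ S}).2.2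
  refine (Submodule.finrank_mono (sup_le (sup_le (sup_le hℓ₁S hℓ₂S) hr₁S) hr₂S)).trans ?_
  have h₁ := Submodule.finrank_sup_add_finrank_inf_eq ℓ₁ ℓ₂
  have h₂ := Submodule.finrank_mono (le_inf hpℓ₁ hpℓ₂)
  have h₃ := Submodule.finrank_add_le_finrank_add_finrank (ℓ₁ ⊔ ℓ₂) p₂
  have h₄ := (hLine ℓ₁ hℓ₁).1
  have h₅ := (hLine ℓ₂ hℓ₂).1
  unfold IsProjPoint at hp₁ hp₂
  rw [hS]
  omega
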